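/- Ramanujan's identity: Li₂(−1/2) + (1/6)·Li₂(1/9) = −π²/18 + (ln 2)·(ln 3) − (1/2)·(ln 2)² − (1/3)·(ln 3)². -/

import Mathlib

open Real

/-- The dilogarithm, `Li₂(z) = ∑_{k=1}^∞ z^k / k²`. -/
noncomputable def Li2 (z : ℝ) : ℝ := ∑' k : ℕ, z ^ (k + 1) / ((k : ℝ) + 1) ^ 2

open Set Filter Topology

theorem hasSum_one_div_succ_sq : HasSum (fun k : ℕ => 1 / ((k : ℝ) + 1) ^ 2) (π ^ 2 / 6) := by
  have h := (hasSum_nat_add_iff' 1).2 hasSum_zeta_two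
  simpa using h

theorem norm_Li2_term_le {z : ℝ} (hz : |z| ≤ 1) (k : ℕ) :
    ‖z ^ (k + 1) / ((k : ℝ) + 1) ^ 2‖ ≤ 1 / ((k : ℝ) + 1) ^ 2 := by
  rw [norm_div, norm_pow, norm_pow, Real.norm_eq_abs, Real.norm_eq_abs,
    abs_of_nonneg (by positivity : (0 : ℝ) ≤ (k : ℝ) + 1)]
  gcongr
  exact pow_le_one₀ (abs_nonneg z) hz

theorem summable_Li2 {z : ℝ} (hz : |z| ≤ 1) :
    Summable fun k : ℕ => z ^ (k + 1) / ((k : ℝ) + 1) ^ 2 :=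
  Summable.of_norm_bounded hasSum_one_div_succ_sq.summable (norm_Li2_term_le hz)

theorem continuousOn_Li2 : ContinuousOn Li2 (Icc (-1) 1) := by
  unfold Li2
  refine continuousOn_tsum (fun k => by fun_prop) hasSum_one_div_succ_sq.summable ?_
  intro k z hz
  exact norm_Li2_term_le (abs_le.2 hz) k

theorem Li2_zero : Li2 0 = 0 := by simp [Li2]

theorem Li2_one : Li2 1 = π ^ 2 / 6 := by
  simpa [Li2] using hasSum_one_div_succ_sq.tsum_eq

theorem Li2_sq {z : ℝ} (hz : |z| ≤ 1) : Li2 (z ^ 2) = 2 * (Li2 z + Li2 (-z)) := by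
  have h₁ := summable_Li2 hz
  have h₂ := summable_Li2 (z := -z) (by rwa [abs_neg])
  have h₃ : Summable fun k : ℕ => (z ^ 2) ^ (k + 1) / ((k : ℝ) + 1) ^ 2 :=
    summable_Li2 (by rw [abs_pow]; exact pow_le_one₀ (abs_nonneg z) hz)
  set f : ℕ → ℝ := fun k => z ^ (k + 1) / ((k : ℝ) + 1) ^ 2 + (-z) ^ (k + 1) / ((k : ℝ) + 1) ^ 2
    with hf
  have he : HasSum (fun k => f (2 * k)) 0 := by
    have : (fun k => f (2 * k)) = fun _ => 0 := by
      funext k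
      rw [hf]
      dsimp only
      rw [(odd_two_mul_add_one k).neg_pow]
      ring
    rw [this]
    exact hasSum_zero
  have ho : HasSum (fun k => f (2 * k + 1)) (1 / 2 * Li2 (z ^ 2)) := by
    have : (fun k => f (2 * k + 1)) =
        fun k : ℕ => 1 / 2 * ((z ^ 2) ^ (k + 1) / ((k : ℝ) + 1) ^ 2) := by
      funext k
      rw [hf]
      dsimp only
      rw [Even.neg_pow ⟨k + 1, by ring⟩, ← pow_mul]
      push_cast
      rw [show 2 * (k : ℝ) + 1 + 1 = 2 * (k + 1) by ring]
      have : (k : ℝ) + 1 ≠ 0 := by positivity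
      field_simp
      ring
    rw [this]
    exact h₃.hasSum.mul_left (1 / 2)
  have h : 0 + 1 / 2 * Li2 (z ^ 2) = Li2 z + Li2 (-z) :=
    (he.even_add_odd ho).unique (h₁.hasSum.add h₂.hasSum)
  linarith

theorem hasDerivAt_Li2 {z : ℝ} (hz : |z| < 1) (h0 : z ≠ 0) :
    HasDerivAt Li2 (-log (1 - z) / z) z := by
  obtain ⟨r, hzr, hr⟩ := exists_between hz
  have hr0 : 0 ≤ r := (abs_nonneg z).trans hzr.le
  have hd : HasDerivAt Li2 (∑' k : ℕ, z ^ k / ((k : ℝ) + 1)) z := by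
    unfold Li2
    refine hasDerivAt_tsum_of_isPreconnected (u := fun k : ℕ => r ^ k) (t := Ioo (-r) r)
      (g' := fun k y => y ^ k / ((k : ℝ) + 1)) (summable_geometric_of_lt_one hr0 hr) isOpen_Ioo
      isPreconnected_Ioo ?_ ?_ (abs_lt.1 hzr) (summable_Li2 hz.le) (abs_lt.1 hzr)
    · intro k y _
      have h := (hasDerivAt_pow (k + 1) y).div_const (((k : ℝ) + 1) ^ 2)
      convert! h using 1
      have : (k : ℝ) + 1 ≠ 0 := by positivity
      push_cast
      field_simp
    · intro k y hy
      rw [norm_div, norm_pow, Real.norm_eq_abs, Real.norm_eq_abs,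
        abs_of_nonneg (by positivity : (0 : ℝ) ≤ (k : ℝ) + 1)]
      calc |y| ^ k / ((k : ℝ) + 1) ≤ |y| ^ k := div_le_self (by positivity) (by simp)
        _ ≤ r ^ k := by gcongr; exact (abs_lt.2 hy).le
  convert! hd using 1
  have h := (hasSum_pow_div_log_of_abs_lt_one hz).div_const z
  rw [← h.tsum_eq]
  refine tsum_congr fun k => ?_
  have : (k : ℝ) + 1 ≠ 0 := by positivity
  field_simp
  ring

theorem tendsto_log_mul_nhdsGT_zero {f : ℝ → ℝ} (hf : DifferentiableAt ℝ f 0) (h0 : f 0 = 0) :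
    Tendsto (fun x => log x * f x) (𝓝[>] 0) (𝓝 0) := by
  have hO : f =O[𝓝[>] 0] fun x => x := by
    simpa [h0] using hf.isBigO_sub.mono (nhdsWithin_le_nhds (s := Ioi 0))
  exact ((Asymptotics.isBigO_refl log _).mul hO).trans_tendsto <| by
    simpa using tendsto_log_mul_rpow_nhdsGT_zero one_pos

theorem eq_of_hasDerivAt_zero_of_tendsto {f : ℝ → ℝ} {c x : ℝ}
    (hd : ∀ y ∈ Ioo (0 : ℝ) 1, HasDerivAt f 0 y) (hf : Tendsto f (𝓝[>] 0) (𝓝 c))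
    (hx : x ∈ Ioo (0 : ℝ) 1) : f x = c := by
  refine tendsto_nhds_unique (tendsto_const_nhds.congr' ?_) hf
  filter_upwards [Ioo_mem_nhdsGT (zero_lt_one' ℝ)] with y hy
  exact isOpen_Ioo.is_const_of_deriv_eq_zero isPreconnected_Ioo
    (fun z hz => (hd z hz).differentiableAt.differentiableWithinAt)
    (fun z hz => (hd z hz).deriv) hx hy

theorem tendsto_Li2_comp {g : ℝ → ℝ} (hg : ContinuousAt g 0)
    (hmem : ∀ x ∈ Ioo (0 : ℝ) 1, g x ∈ Icc (-1 : ℝ) 1) (h0 : g 0 ∈ Icc (-1 : ℝ) 1) :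
    Tendsto (fun x => Li2 (g x)) (𝓝[>] 0) (𝓝 (Li2 (g 0))) := by
  refine (continuousOn_Li2 _ h0).tendsto.comp (tendsto_nhdsWithin_iff.2 ⟨?_, ?_⟩)
  · exact hg.tendsto.mono_left nhdsWithin_le_nhds
  · filter_upwards [Ioo_mem_nhdsGT (zero_lt_one' ℝ)] with x hx using hmem x hx

/-- Euler's reflection formula. -/
theorem Li2_add_Li2_one_sub {x : ℝ} (hx : x ∈ Ioo (0 : ℝ) 1) :
    Li2 x + Li2 (1 - x) + log x * log (1 - x) = π ^ 2 / 6 := by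
  refine eq_of_hasDerivAt_zero_of_tendsto
    (f := fun x => Li2 x + Li2 (1 - x) + log x * log (1 - x)) ?_ ?_ hx
  · rintro y ⟨hy0, hy1⟩
    have hy : 1 - y ≠ 0 := by linarith
    have hs : HasDerivAt (fun y : ℝ => 1 - y) (-1) y := (hasDerivAt_id y).const_sub 1
    have h₁ := hasDerivAt_Li2 (abs_lt.2 ⟨by linarith, hy1⟩) hy0.ne'
    have h₂ := (hasDerivAt_Li2 (abs_lt.2 ⟨by linarith, by linarith⟩) hy).comp y hs
    have h₃ := (hasDerivAt_log hy0.ne').mul (hs.log hy)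
    convert! (h₁.add h₂).add h₃ using 1
    rw [sub_sub_cancel]
    field_simp
    ring
  · have h₁ := tendsto_Li2_comp (g := fun x => x) (by fun_prop)
      (fun x hx => ⟨by linarith [hx.1], hx.2.le⟩) (by norm_num)
    have h₂ := tendsto_Li2_comp (g := fun x => 1 - x) (by fun_prop)
      (fun x hx => ⟨by linarith [hx.2], by linarith [hx.1]⟩) (by norm_num)
    have h₃ := tendsto_log_mul_nhdsGT_zero (f := fun x => log (1 - x))
      (DifferentiableAt.log (by fun_prop) (by norm_num)) (by simp)
    convert! (h₁.add h₂).add h₃ using 2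
    simp [Li2_zero, Li2_one]

/-- Landen's identity, in the variable `y = x / (1 - x)`. -/
theorem Li2_div_one_add_add_Li2_neg {y : ℝ} (hy : y ∈ Ioo (0 : ℝ) 1) :
    Li2 (y / (1 + y)) + Li2 (-y) + 1 / 2 * log (1 + y) ^ 2 = 0 := by
  have hmem : ∀ y ∈ Ioo (0 : ℝ) 1, 0 < y / (1 + y) ∧ y / (1 + y) < 1 := by
    rintro y ⟨h0, h1⟩
    exact ⟨by positivity, by rw [div_lt_one (by linarith)]; linarith⟩
  refine eq_of_hasDerivAt_zero_of_tendsto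
    (f := fun y => Li2 (y / (1 + y)) + Li2 (-y) + 1 / 2 * log (1 + y) ^ 2) ?_ ?_ hy
  · intro y hy
    obtain ⟨hy0, hy1⟩ := hy
    obtain ⟨hm0, hm1⟩ := hmem y ⟨hy0, hy1⟩
    have h1y : 1 + y ≠ 0 := by linarith
    have hs : HasDerivAt (fun y : ℝ => 1 + y) 1 y := (hasDerivAt_id y).const_add 1
    have h₁ := (hasDerivAt_Li2 (abs_lt.2 ⟨by linarith, hm1⟩) hm0.ne').comp y
      ((hasDerivAt_id y).div hs h1y)
    have h₂ := (hasDerivAt_Li2 (z := -y) (abs_lt.2 ⟨by linarith, by linarith⟩)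
      (by linarith)).comp y (hasDerivAt_neg y)
    have h₃ := ((hs.log h1y).pow 2).const_mul (1 / 2)
    convert! (h₁.add h₂).add h₃ using 1
    have hl : 1 - y / (1 + y) = (1 + y)⁻¹ := by field_simp; ring
    rw [hl, log_inv, sub_neg_eq_add]
    simp only [id]
    field_simp
    ring
  · have h₁ := tendsto_Li2_comp (g := fun y => y / (1 + y))
      (ContinuousAt.div (by fun_prop) (by fun_prop) (by norm_num))
      (fun x hx => ⟨by linarith [(hmem x hx).1], (hmem x hx).2.le⟩) (by norm_num)
    have h₂ := tendsto_Li2_comp (g := fun x => -x) (by fun_prop)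
      (fun x hx => ⟨by linarith [hx.2], by linarith [hx.1]⟩) (by norm_num)
    have h₃ : Tendsto (fun y : ℝ => 1 / 2 * log (1 + y) ^ 2) (𝓝[>] 0)
        (𝓝 (1 / 2 * log (1 + 0) ^ 2)) := by
      refine ContinuousAt.tendsto (x := (0 : ℝ)) ?_ |>.mono_left nhdsWithin_le_nhds
      exact (((continuousAt_const.add continuousAt_id).log (by norm_num)).pow 2).const_mul _
    convert! (h₁.add h₂).add h₃ using 2
    simp [Li2_zero]

/-- The inversion formula for twice the Legendre chi function `Li₂(x) - Li₂(-x)`. -/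
theorem Li2_sub_Li2_neg_add_cayley {x : ℝ} (hx : x ∈ Ioo (0 : ℝ) 1) :
    Li2 ((1 - x) / (1 + x)) - Li2 (-((1 - x) / (1 + x))) + (Li2 x - Li2 (-x)) -
      log x * (log (1 + x) - log (1 - x)) = π ^ 2 / 4 := by
  have hmem : ∀ y ∈ Ioo (0 : ℝ) 1, 0 < (1 - y) / (1 + y) ∧ (1 - y) / (1 + y) < 1 := by
    rintro y ⟨h0, h1⟩
    exact ⟨div_pos (by linarith) (by linarith), by rw [div_lt_one (by linarith)]; linarith⟩
  refine eq_of_hasDerivAt_zero_of_tendsto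
    (f := fun x => Li2 ((1 - x) / (1 + x)) - Li2 (-((1 - x) / (1 + x))) + (Li2 x - Li2 (-x)) -
      log x * (log (1 + x) - log (1 - x))) ?_ ?_ hx
  · intro y hy
    obtain ⟨hy0, hy1⟩ := hy
    obtain ⟨hm0, hm1⟩ := hmem y ⟨hy0, hy1⟩
    have hp : 1 + y ≠ 0 := by linarith
    have hm : 1 - y ≠ 0 := by linarith
    have hsp : HasDerivAt (fun y : ℝ => 1 + y) 1 y := (hasDerivAt_id y).const_add 1
    have hsm : HasDerivAt (fun y : ℝ => 1 - y) (-1) y := (hasDerivAt_id y).const_sub 1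
    have hq := hsm.div hsp hp
    have h₁ := (hasDerivAt_Li2 (abs_lt.2 ⟨by linarith, hm1⟩) hm0.ne').comp y hq
    have h₂ := (hasDerivAt_Li2 (z := -((1 - y) / (1 + y)))
      (abs_lt.2 ⟨by linarith, by linarith⟩) (by linarith)).comp y hq.neg
    have h₃ := hasDerivAt_Li2 (abs_lt.2 ⟨by linarith, hy1⟩) hy0.ne'
    have h₄ := (hasDerivAt_Li2 (z := -y) (abs_lt.2 ⟨by linarith, by linarith⟩)
      (by linarith)).comp y (hasDerivAt_neg y)
    have h₅ := (hasDerivAt_log hy0.ne').mul ((hsp.log hp).sub (hsm.log hm))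
    convert! ((h₁.sub h₂).add (h₃.sub h₄)).sub h₅ using 1
    have hl₁ : 1 - (1 - y) / (1 + y) = 2 * y / (1 + y) := by field_simp; ring
    have hl₂ : 1 - -((1 - y) / (1 + y)) = 2 / (1 + y) := by field_simp; ring
    rw [hl₁, hl₂, log_div (by positivity) hp, log_div two_ne_zero hp,
      log_mul two_ne_zero hy0.ne', sub_neg_eq_add]
    simp only [Pi.sub_apply]
    field_simp
    ring
  · have hc : ContinuousAt (fun x : ℝ => (1 - x) / (1 + x)) 0 :=
      ContinuousAt.div (by fun_prop) (by fun_prop) (by norm_num)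
    have h₁ := tendsto_Li2_comp hc
      (fun x hx => ⟨by linarith [(hmem x hx).1], (hmem x hx).2.le⟩) (by norm_num)
    have h₂ := tendsto_Li2_comp hc.neg
      (fun x hx => ⟨by simpa using (hmem x hx).2.le,
        by simpa using (by linarith [(hmem x hx).1] : -((1 - x) / (1 + x)) ≤ 1)⟩) (by norm_num)
    have h₃ := tendsto_Li2_comp (g := fun x => x) (by fun_prop)
      (fun x hx => ⟨by linarith [hx.1], hx.2.le⟩) (by norm_num)
    have h₄ := tendsto_Li2_comp (g := fun x => -x) (by fun_prop)
      (fun x hx => ⟨by linarith [hx.2], by linarith [hx.1]⟩) (by norm_num)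
    have h₅ := tendsto_log_mul_nhdsGT_zero (f := fun x => log (1 + x) - log (1 - x))
      ((DifferentiableAt.log (by fun_prop) (by norm_num)).sub
        (DifferentiableAt.log (by fun_prop) (by norm_num))) (by simp)
    have hneg : Li2 (-1) = -(π ^ 2 / 12) := by
      have h := Li2_sq (z := 1) (by norm_num)
      rw [one_pow, Li2_one] at h
      linarith
    convert! ((h₁.sub h₂).add (h₃.sub h₄)).sub h₅ using 2
    simp [Li2_zero, Li2_one, hneg]
    ring

theorem stmt_16 :
    Li2 (-(1 / 2)) + (1 / 6) * Li2 (1 / 9) =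
      -(Real.pi ^ 2) / 18 + Real.log 2 * Real.log 3 - (1 / 2) * (Real.log 2) ^ 2 -
        (1 / 3) * (Real.log 3) ^ 2 := by
  have hhalf : (1 / 2 : ℝ) ∈ Ioo (0 : ℝ) 1 := by norm_num
  have h₁ := Li2_add_Li2_one_sub hhalf
  have h₂ := Li2_div_one_add_add_Li2_neg hhalf
  have h₃ := Li2_sub_Li2_neg_add_cayley hhalf
  have h₄ := Li2_sq (z := 1 / 3) (by norm_num [abs_of_pos])
  have e₁ : (1 - 1 / 2 : ℝ) = 1 / 2 := by norm_num
  have e₂ : (1 / 2 / (1 + 1 / 2) : ℝ) = 1 / 3 := by norm_num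
  have e₃ : ((1 / 3) ^ 2 : ℝ) = 1 / 9 := by norm_num
  have l₁ : log (1 / 2) = -log 2 := by rw [one_div, log_inv]
  have l₂ : log (1 + 1 / 2) = log 3 - log 2 := by
    rw [← log_div (by norm_num) (by norm_num)]
    norm_num
  rw [e₁, l₁] at h₁
  rw [e₂, l₂] at h₂
  rw [e₁, e₂, l₁, l₂] at h₃
  rw [e₃] at h₄
  linear_combination (1 / 6) * h₁ + (2 / 3) * h₂ - (1 / 3) * h₃ + (1 / 6) * h₄
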